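/- Fix integers ℓ, M ≥ 1, a promise template (𝐀,𝐁) over finite domains, and a symmetric polymorphism f of (𝐀,𝐁) of arity L* ≥ Mℓ²; write L* = uℓ + v with u ≥ 0 an integer and 0 ≤ v ≤ ℓ−1 (so u ≥ Mℓ). For each L ≥ 1 let 𝓜^{(L)}_{ℓ,M} be the set of pairs (w,r) ∈ 𝓜_{BLP+Aff}^{(L)} with ℓ·w(i) ∈ ℤ for all i ∈ [L] and Σ_{i∈[L]} |r(i)| ≤ M. Then: (a) the sets 𝓜^{(L)}_{ℓ,M} are closed under the minor operations of 𝓜_{BLP+Aff}; (b) for each (w,r) ∈ 𝓜^{(L)}_{ℓ,M}, the numbers W_i := uℓ·w(i) + v·r(i) are nonnegative integers with Σ_{i∈[L]} W_i = L*, so there exists σ : [L*] → [L] with |σ^{-1}(i)| = W_i for all i; (c) for any such σ, the minor f_{/σ} depends only on (w,r) (not on the choice of σ, by symmetry of f), and the resulting map ξ(w,r) := f_{/σ} satisfies ξ((w,r)_{/π}) = (ξ(w,r))_{/π} for every π : [L] → [L'], with every ξ(w,r) a polymorphism of (𝐀,𝐁). -/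

import Mathlib

/-- `f` is a polymorphism of the promise template given by relations `RA`, `RB`. -/
def IsPolymorphism {ι : Type} {ar : ι → ℕ} {A B : Type}
    (RA : ∀ R : ι, Set (Fin (ar R) → A)) (RB : ∀ R : ι, Set (Fin (ar R) → B))
    {L : ℕ} (f : (Fin L → A) → B) : Prop :=
  ∀ R : ι, ∀ x : Fin L → (Fin (ar R) → A), (∀ l, x l ∈ RA R) →
    (fun k => f (fun l => x l k)) ∈ RB R

/-- `f` is a symmetric function: invariant under all permutations of its arguments. -/
def IsSymmetric {A B : Type} {L : ℕ} (f : (Fin L → A) → B) : Prop :=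
  ∀ (π : Equiv.Perm (Fin L)) (x : Fin L → A), f (x ∘ π) = f x

/-- The defining conditions of an `L`-ary object `(w, r)` of the minion `𝓜_{BLP+Aff}`. -/
def BLPAffCond (L : ℕ) (w : Fin L → ℚ) (r : Fin L → ℤ) : Prop :=
  (∀ i, 0 ≤ w i) ∧ (∑ i, w i = 1) ∧ (∑ i, r i = 1) ∧ (∀ i, w i = 0 → r i = 0)

/-- Membership in the finite sub-family `𝓜^{(L)}_{ℓ,M}` of `𝓜_{BLP+Aff}`. -/
def InSub (ℓ M : ℕ) {L : ℕ} (w : Fin L → ℚ) (r : Fin L → ℤ) : Prop :=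
  BLPAffCond L w r ∧ (∀ i, ∃ z : ℤ, (ℓ : ℚ) * w i = (z : ℚ)) ∧ (∑ i, |r i| ≤ (M : ℤ))

/-- `σ : [L*] → [L]` has fiber over `i` of size exactly `uℓ·w(i) + v·r(i)`. -/
def FiberMatch (ℓ u v : ℕ) {Lstar L : ℕ} (w : Fin L → ℚ) (r : Fin L → ℤ)
    (σ : Fin Lstar → Fin L) : Prop :=
  ∀ i, ((Finset.univ.filter (fun j => σ j = i)).card : ℚ)
    = (u : ℚ) * (ℓ : ℚ) * w i + (v : ℚ) * (r i : ℚ)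

/-- Two maps with equinumerous fibers differ by a permutation of the domain. -/
theorem exists_perm_comp_eq_of_card_fiber_eq {α γ : Type*} [Fintype α] [DecidableEq γ]
    (σ τ : α → γ)
    (h : ∀ c, (Finset.univ.filter (fun a => σ a = c)).card
      = (Finset.univ.filter (fun a => τ a = c)).card) :
    ∃ e : Equiv.Perm α, τ ∘ e = σ := by
  have hc : ∀ c, Nonempty ({a // σ a = c} ≃ {a // τ a = c}) := fun c =>
    Fintype.card_eq.mp (by simpa only [Fintype.card_subtype] using h c)
  exact ⟨Equiv.ofFiberEquiv fun c => (hc c).some, funext fun a => Equiv.ofFiberEquiv_map _ a⟩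

/-- A map with prescribed fiber sizes exists as soon as the sizes add up. -/
theorem exists_card_fiber_eq {n L : ℕ} (W : Fin L → ℕ) (hW : ∑ i, W i = n) :
    ∃ σ : Fin n → Fin L, ∀ i, (Finset.univ.filter (fun j => σ j = i)).card = W i := by
  subst hW
  refine ⟨fun j => (finSigmaFinEquiv.symm j).1, fun i => ?_⟩
  rw [← Fintype.card_subtype, Fintype.card_congr
    ((finSigmaFinEquiv.symm.subtypeEquiv fun j => Iff.rfl).trans (Equiv.sigmaSubtype i))]
  simp

/-- A symmetric function has the same minor along any two maps with equinumerous fibers. -/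
theorem IsSymmetric.minor_eq {A B : Type} {n L : ℕ} {f : (Fin n → A) → B} (hf : IsSymmetric f)
    {σ τ : Fin n → Fin L}
    (h : ∀ c, (Finset.univ.filter (fun a => σ a = c)).card
      = (Finset.univ.filter (fun a => τ a = c)).card) :
    (fun x : Fin L → A => f (x ∘ σ)) = fun x => f (x ∘ τ) := by
  obtain ⟨e, rfl⟩ := exists_perm_comp_eq_of_card_fiber_eq σ τ h
  exact funext fun x => hf e (x ∘ τ)

/-- Minors of polymorphisms are polymorphisms. -/
theorem IsPolymorphism.minor {ι : Type} {ar : ι → ℕ} {A B : Type}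
    {RA : ∀ R : ι, Set (Fin (ar R) → A)} {RB : ∀ R : ι, Set (Fin (ar R) → B)}
    {n L : ℕ} {f : (Fin n → A) → B} (hf : IsPolymorphism RA RB f) (σ : Fin n → Fin L) :
    IsPolymorphism RA RB (fun x : Fin L → A => f (x ∘ σ)) :=
  fun R x hx => hf R (x ∘ σ) fun l => hx (σ l)

theorem InSub.minor {ℓ M L L' : ℕ} (π : Fin L → Fin L') {w : Fin L → ℚ} {r : Fin L → ℤ}
    (h : InSub ℓ M w r) :
    InSub ℓ M (fun i => ∑ j ∈ Finset.univ.filter (fun j => π j = i), w j)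
      (fun i => ∑ j ∈ Finset.univ.filter (fun j => π j = i), r j) := by
  obtain ⟨⟨hw, hw1, hr1, hwr⟩, hz, hM⟩ := h
  choose z hz using hz
  refine ⟨⟨fun i => Finset.sum_nonneg fun j _ => hw j, ?_, ?_, fun i hi => ?_⟩, fun i => ?_, ?_⟩
  · rw [Finset.sum_fiberwise, hw1]
  · rw [Finset.sum_fiberwise, hr1]
  · rw [Finset.sum_eq_zero_iff_of_nonneg fun j _ => hw j] at hi
    exact Finset.sum_eq_zero fun j hj => hwr j (hi j hj)
  · refine ⟨∑ j ∈ Finset.univ.filter (fun j => π j = i), z j, ?_⟩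
    rw [Finset.mul_sum, Int.cast_sum]
    exact Finset.sum_congr rfl fun j _ => hz j
  · calc _ ≤ ∑ i, ∑ j ∈ Finset.univ.filter (fun j => π j = i), |r j| :=
          Finset.sum_le_sum fun i _ => Finset.abs_sum_le_sum_abs _ _
      _ = ∑ j, |r j| := Finset.sum_fiberwise _ _ _
      _ ≤ M := hM

/-- The prescribed fiber sizes are natural numbers. -/
theorem InSub.exists_nat_eq {ℓ M u v L : ℕ} (hu : M * ℓ ≤ u) (hv : v < ℓ)
    {w : Fin L → ℚ} {r : Fin L → ℤ} (h : InSub ℓ M w r) (i : Fin L) :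
    ∃ n : ℕ, (n : ℚ) = (u : ℚ) * (ℓ : ℚ) * w i + (v : ℚ) * (r i : ℚ) := by
  obtain ⟨⟨hw, -, -, hwr⟩, hz, hM⟩ := h
  obtain ⟨z, hz⟩ := hz i
  have hz0 : 0 ≤ z := by
    have : (0 : ℚ) ≤ z := hz ▸ mul_nonneg (Nat.cast_nonneg _) (hw i)
    exact_mod_cast this
  have hr : |r i| ≤ M :=
    (Finset.single_le_sum (f := fun i => |r i|) (fun _ _ => abs_nonneg _)
      (Finset.mem_univ i)).trans hM
  have hnonneg : 0 ≤ (u : ℤ) * z + v * r i := by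
    rcases hz0.eq_or_lt with rfl | hpos
    · have hℓ : (ℓ : ℚ) ≠ 0 := by
        have : ℓ ≠ 0 := by lia
        exact_mod_cast this
      have hwi : w i = 0 := by simpa [hℓ] using hz
      simp [hwr i hwi]
    · have h1 : (u : ℤ) ≤ u * z := le_mul_of_one_le_right (by positivity) hpos
      have h2 : (v : ℤ) * |r i| ≤ ℓ * M := by gcongr
      have h3 : (v : ℤ) * -|r i| ≤ v * r i := by
        gcongr
        exact neg_abs_le _
      have h4 : (M : ℤ) * ℓ ≤ u := by exact_mod_cast hu
      linarith
  obtain ⟨n, hn⟩ := Int.eq_ofNat_of_zero_le hnonneg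
  refine ⟨n, ?_⟩
  rw [mul_assoc, hz]
  exact_mod_cast hn.symm

theorem BLPAffCond.sum_fiber_sizes {L : ℕ} {w : Fin L → ℚ} {r : Fin L → ℤ}
    (h : BLPAffCond L w r) (ℓ u v : ℕ) :
    ∑ i, ((u : ℚ) * (ℓ : ℚ) * w i + (v : ℚ) * (r i : ℚ)) = (u * ℓ + v : ℕ) := by
  have hr : ∑ i, (r i : ℚ) = 1 := by exact_mod_cast h.2.2.1
  rw [Finset.sum_add_distrib, ← Finset.mul_sum, ← Finset.mul_sum, h.2.1, hr]
  push_cast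
  ring

/-- Composing with `π` sends fiber-matching maps for `(w, r)` to those for its minor. -/
theorem FiberMatch.minor {ℓ u v n L L' : ℕ} {w : Fin L → ℚ} {r : Fin L → ℤ}
    {σ : Fin n → Fin L} (h : FiberMatch ℓ u v w r σ) (π : Fin L → Fin L') :
    FiberMatch ℓ u v (fun i => ∑ j ∈ Finset.univ.filter (fun j => π j = i), w j)
      (fun i => ∑ j ∈ Finset.univ.filter (fun j => π j = i), r j) (π ∘ σ) := by
  intro i
  rw [Finset.card_eq_sum_card_fiberwise (f := σ)
    (t := Finset.univ.filter (fun j => π j = i)) (fun a ha => by simpa using ha)]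
  push_cast
  rw [Finset.mul_sum, Finset.mul_sum, ← Finset.sum_add_distrib]
  refine Finset.sum_congr rfl fun j hj => ?_
  rw [← h j, Finset.filter_filter]
  congr 2
  ext a
  simp only [Finset.mem_filter, Finset.mem_univ, true_and] at hj ⊢
  exact ⟨And.right, fun ha => ⟨by simp [ha, hj], ha⟩⟩

/-- Two maps matching the same `(w, r)` have fibers of equal size. -/
theorem FiberMatch.card_eq {ℓ u v n L : ℕ} {w : Fin L → ℚ} {r : Fin L → ℤ}
    {σ τ : Fin n → Fin L} (hσ : FiberMatch ℓ u v w r σ) (hτ : FiberMatch ℓ u v w r τ)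
    (c : Fin L) :
    (Finset.univ.filter (fun a => σ a = c)).card
      = (Finset.univ.filter (fun a => τ a = c)).card := by
  exact_mod_cast (hσ c).trans (hτ c).symm

/-- Construction of a minion homomorphism on `𝓜_{ℓ,M}` from a
symmetric polymorphism `f` of arity `L* ≥ Mℓ²`: (a) the sets `𝓜^{(L)}_{ℓ,M}` are closed
under minors; (b) the numbers `W i = uℓ·w(i) + v·r(i)` are nonnegative integers summing
to `L*`, so a map `σ : [L*] → [L]` with these fiber sizes exists; (c) the minor `f_{/σ}`
is independent of the choice of `σ`, is a polymorphism, and the assignment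
`(w,r) ↦ f_{/σ}` commutes with taking minors. -/
theorem stmt_11 {ι : Type} [Fintype ι] {ar : ι → ℕ} (har : ∀ R, 1 ≤ ar R)
    {A B : Type} [Fintype A] [Fintype B]
    (RA : ∀ R : ι, Set (Fin (ar R) → A))
    (RB : ∀ R : ι, Set (Fin (ar R) → B))
    (hAB : ∃ h : A → B, ∀ R : ι, ∀ t ∈ RA R, (fun k => h (t k)) ∈ RB R)
    (ℓ M : ℕ) (hℓ : 1 ≤ ℓ) (hM : 1 ≤ M)
    {Lstar : ℕ} (hLstar : M * ℓ ^ 2 ≤ Lstar)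
    (f : (Fin Lstar → A) → B)
    (hpoly : IsPolymorphism RA RB f) (hsym : IsSymmetric f)
    (u v : ℕ) (huv : Lstar = u * ℓ + v) (hv : v < ℓ) :
    -- the division yields `u ≥ Mℓ`
    (M * ℓ ≤ u) ∧
    -- (a) closure under minors
    (∀ (L L' : ℕ) (π : Fin L → Fin L') (w : Fin L → ℚ) (r : Fin L → ℤ),
      InSub ℓ M w r →
      InSub ℓ M (fun i => ∑ j ∈ Finset.univ.filter (fun j => π j = i), w j)
        (fun i => ∑ j ∈ Finset.univ.filter (fun j => π j = i), r j)) ∧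
    -- (b) the `W i` are nonnegative integers summing to `L*`, and a suitable `σ` exists
    (∀ (L : ℕ) (w : Fin L → ℚ) (r : Fin L → ℤ), InSub ℓ M w r →
      (∀ i, ∃ Wi : ℕ, (Wi : ℚ) = (u : ℚ) * (ℓ : ℚ) * w i + (v : ℚ) * (r i : ℚ)) ∧
      (∑ i, ((u : ℚ) * (ℓ : ℚ) * w i + (v : ℚ) * (r i : ℚ)) = (Lstar : ℚ)) ∧
      ∃ σ : Fin Lstar → Fin L, FiberMatch ℓ u v w r σ) ∧
    -- (c) well-definedness of `ξ`
    (∀ (L : ℕ) (w : Fin L → ℚ) (r : Fin L → ℤ), InSub ℓ M w r →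
      ∀ σ σ' : Fin Lstar → Fin L, FiberMatch ℓ u v w r σ → FiberMatch ℓ u v w r σ' →
        (fun x : Fin L → A => f (x ∘ σ)) = (fun x => f (x ∘ σ'))) ∧
    -- (c) each `ξ(w,r)` is a polymorphism
    (∀ (L : ℕ) (w : Fin L → ℚ) (r : Fin L → ℤ), InSub ℓ M w r →
      ∀ σ : Fin Lstar → Fin L, FiberMatch ℓ u v w r σ →
        IsPolymorphism RA RB (fun x : Fin L → A => f (x ∘ σ))) ∧
    -- (c) `ξ` commutes with minors
    (∀ (L L' : ℕ) (π : Fin L → Fin L') (w : Fin L → ℚ) (r : Fin L → ℤ),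
      InSub ℓ M w r →
      ∀ σ : Fin Lstar → Fin L, FiberMatch ℓ u v w r σ →
      ∀ σ' : Fin Lstar → Fin L',
        FiberMatch ℓ u v (fun i => ∑ j ∈ Finset.univ.filter (fun j => π j = i), w j)
          (fun i => ∑ j ∈ Finset.univ.filter (fun j => π j = i), r j) σ' →
        (fun x : Fin L' → A => f (x ∘ σ')) = (fun x => f ((x ∘ π) ∘ σ))) := by
  have hu : M * ℓ ≤ u := by
    by_contra! hlt
    have : (u + 1) * ℓ ≤ M * ℓ * ℓ := Nat.mul_le_mul_right ℓ hlt
    nlinarith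
  refine ⟨hu, fun L L' π w r h => h.minor π, fun L w r h => ?_,
    fun L w r _ σ σ' hσ hσ' => hsym.minor_eq (hσ.card_eq hσ'),
    fun L w r _ σ _ => hpoly.minor σ,
    fun L L' π w r _ σ hσ σ' hσ' => hsym.minor_eq (hσ'.card_eq (hσ.minor π))⟩
  have hsum := huv ▸ h.1.sum_fiber_sizes ℓ u v
  have hnat := h.exists_nat_eq hu hv
  refine ⟨hnat, hsum, ?_⟩
  choose W hW using hnat
  have hWsum : ∑ i, W i = Lstar := by
    simp only [← hW] at hsum
    exact_mod_cast hsum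
  obtain ⟨σ, hσ⟩ := exists_card_fiber_eq W hWsum
  exact ⟨σ, fun i => by rw [hσ i, hW i]⟩
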